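/- arXiv:2012.15722 — 2 statements merged into one kernel-verified Lean document; each statement's English description precedes it below -/
import Mathlib

section
/- Let M ≥ 2 and let H be a finite graph that is a κ-expander. Suppose G is obtained from H by replacing each edge of H by a path with at most M edges (i.e., G is a subdivision of H in which every subdividing path has at most M edges, and every vertex and edge of G belongs to one of these paths or to the image of V(H)). Then G is a κ/(2M−1)-expander. -/
/-- The number of edges of a graph. -/
noncomputable def edgeCount {V : Type*} (G : SimpleGraph V) : ℕ :=
  Nat.card G.edgeSet

/-- The degree of a vertex. -/
noncomputable def vdeg {V : Type*} (G : SimpleGraph V) (v : V) : ℕ :=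
  Nat.card (G.neighborSet v)

/-- The volume of a vertex set: the sum of the degrees of its vertices. -/
noncomputable def vol {V : Type*} (G : SimpleGraph V) (X : Set V) : ℕ :=
  ∑ᶠ v ∈ X, vdeg G v

/-- The number of edges with exactly one endpoint in `X` (counted via ordered pairs
`(x, y)` with `x ∈ X`, `y ∉ X`, `Adj x y`; each crossing edge gives exactly one such pair). -/
noncomputable def cut {V : Type*} (G : SimpleGraph V) (X : Set V) : ℕ :=
  Nat.card {p : V × V // p.1 ∈ X ∧ p.2 ∉ X ∧ G.Adj p.1 p.2}

/-- A graph is a `κ`-expander if every vertex set `X` satisfies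
`e(X, X̄) ≥ κ · min (vol X) (vol X̄)`. -/
def IsExpander {V : Type*} (G : SimpleGraph V) (κ : ℝ) : Prop :=
  ∀ X : Set V, κ * min (vol G X : ℝ) (vol G Xᶜ : ℝ) ≤ (cut G X : ℝ)

/-- The internal vertices of a walk: its support with the two endpoints removed. -/
def walkInternal {V : Type*} {G : SimpleGraph V} {u v : V} (p : G.Walk u v) : List V :=
  p.support.tail.dropLast

/-- `G` is a subdivision of `H` in which every subdividing path has at most `M` edges:
there are an injection `φ : V(H) → V(G)` and, for each edge `{u, v}` of `H`, a path in `G`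
from `φ u` to `φ v` with at least 1 and at most `M` edges (the choice depending only on the
edge, not its orientation), such that these paths are pairwise internally vertex-disjoint,
their internal vertices avoid `φ(V(H))`, and every vertex and every edge of `G` lies in the
image of `φ` or on one of these paths. -/
def IsSubdivisionLE {W V : Type*} (G : SimpleGraph V) (H : SimpleGraph W) (M : ℕ) : Prop :=
  ∃ (φ : W → V) (P : ∀ u v : W, H.Adj u v → G.Walk (φ u) (φ v)),
    Function.Injective φ ∧
    (∀ u v huv, (P u v huv).IsPath) ∧
    (∀ u v huv, 1 ≤ (P u v huv).length) ∧
    (∀ u v huv, (P u v huv).length ≤ M) ∧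
    (∀ u v huv, P v u huv.symm = (P u v huv).reverse) ∧
    (∀ u v huv, ∀ w ∈ walkInternal (P u v huv), w ∉ Set.range φ) ∧
    (∀ u v huv u' v' huv', s(u, v) ≠ s(u', v') →
      ∀ w ∈ walkInternal (P u v huv), w ∉ walkInternal (P u' v' huv')) ∧
    (∀ x : V, x ∈ Set.range φ ∨ ∃ u v huv, x ∈ (P u v huv).support) ∧
    (∀ e ∈ G.edgeSet, ∃ u v huv, e ∈ (P u v huv).edges)

open Classical in
theorem aux_vol_eq {V : Type*} [Fintype V] (G : SimpleGraph V) (X : Set V) :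
    vol G X = (Finset.univ.filter (fun p : V × V => p.1 ∈ X ∧ G.Adj p.1 p.2)).card := by
  have h1 : vol G X = ∑ v ∈ Finset.univ.filter (fun v => v ∈ X), vdeg G v := by
    unfold vol
    rw [finsum_mem_eq_sum_of_inter_support_eq]
    ext v; simp
  rw [h1, Finset.card_eq_sum_card_fiberwise (f := Prod.fst) (t := Finset.univ.filter (fun v => v ∈ X))]
  · refine Finset.sum_congr rfl fun v hv => ?_
    have hv' : v ∈ X := by simpa using hv
    unfold vdeg
    rw [Nat.card_eq_fintype_card, Fintype.card_subtype]
    refine Finset.card_bij (fun w _ => (v, w)) ?_ ?_ ?_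
    · intro w hw
      simp at hw
      simp [hv', hw]
    · intro a _ b _ h
      simpa using h
    · rintro ⟨a, b⟩ h
      simp at h
      obtain ⟨⟨h1, h2⟩, rfl⟩ := h
      exact ⟨b, by simpa using h2, rfl⟩
  · intro p hp
    simp at hp ⊢
    exact hp.1

open Classical in
theorem aux_cut_eq {V : Type*} [Fintype V] (G : SimpleGraph V) (X : Set V) :
    cut G X = (Finset.univ.filter
      (fun p : V × V => p.1 ∈ X ∧ p.2 ∉ X ∧ G.Adj p.1 p.2)).card := by
  unfold cut
  rw [Nat.card_eq_fintype_card, Fintype.card_subtype]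

theorem aux_cut_compl {V : Type*} (G : SimpleGraph V) (X : Set V) :
    cut G Xᶜ = cut G X := by
  unfold cut
  refine Nat.card_congr ⟨fun p => ⟨(p.1.2, p.1.1), ?_⟩, fun p => ⟨(p.1.2, p.1.1), ?_⟩, ?_, ?_⟩
  · have := p.2
    simp only [Set.mem_compl_iff, not_not] at this
    exact ⟨this.2.1, this.1, this.2.2.symm⟩
  · have := p.2
    simp only [Set.mem_compl_iff, not_not]
    exact ⟨this.2.1, this.1, this.2.2.symm⟩
  · intro p; rfl
  · intro p; rfl

theorem aux_cut_le_vol {V : Type*} [Fintype V] (G : SimpleGraph V) (X : Set V) :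
    cut G X ≤ vol G X := by
  classical
  rw [aux_cut_eq, aux_vol_eq]
  refine Finset.card_le_card fun p hp => ?_
  simp at hp ⊢
  exact ⟨hp.1, hp.2.2⟩

theorem aux_exists_cross {V : Type*} {G : SimpleGraph V} (X : Set V) {a b : V}
    (p : G.Walk a b) (ha : a ∉ X) (z : V) (hz : z ∈ p.support) (hzX : z ∈ X) :
    ∃ d ∈ p.darts, d.fst ∉ X ∧ d.snd ∈ X := by
  induction p with
  | nil => simp at hz; subst hz; exact absurd hzX ha
  | @cons u v w h p ih =>
    by_cases hv : v ∈ X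
    · exact ⟨⟨(u, v), h⟩, by simp, ha, hv⟩
    · have : z ∈ p.support := by
        simp at hz
        rcases hz with rfl | hz
        · exact absurd hzX ha
        · exact hz
      obtain ⟨d, hd, h1⟩ := ih hv this
      exact ⟨d, by simp [hd], h1⟩

theorem aux_support_cases {V : Type*} {G : SimpleGraph V} {a b : V}
    (p : G.Walk a b) (z : V) (hz : z ∈ p.support) :
    z = a ∨ z = b ∨ z ∈ walkInternal p := by
  unfold walkInternal
  cases p with
  | nil => simp at hz; exact Or.inl hz
  | cons h p =>
    simp at hz ⊢
    rcases hz with h | hz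
    · exact Or.inl h
    · right
      rw [← List.dropLast_append_getLast (SimpleGraph.Walk.support_ne_nil p)] at hz
      rw [List.mem_append] at hz
      rcases hz with hz | hz
      · exact Or.inr hz
      · left; simpa using hz

theorem aux_path_fst_ne {V : Type*} {G : SimpleGraph V} {a b : V}
    (p : G.Walk a b) (hp : p.IsPath) (d : G.Dart) (hd : d ∈ p.darts) : d.fst ≠ b := by
  induction p with
  | nil => simp at hd
  | @cons u v w h p ih =>
    rw [SimpleGraph.Walk.cons_isPath_iff] at hp
    simp at hd
    rcases hd with rfl | hd
    · rintro h
      simp at h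
      subst h
      exact hp.2 p.end_mem_support
    · exact ih hp.1 hd

theorem aux_path_snd_ne {V : Type*} {G : SimpleGraph V} {a b : V}
    (p : G.Walk a b) (hp : p.IsPath) (d : G.Dart) (hd : d ∈ p.darts) : d.snd ≠ a := by
  have := aux_path_fst_ne p.reverse hp.reverse d.symm (by
    simpa using hd)
  simpa using this

theorem aux_path_symm {V : Type*} {G : SimpleGraph V} {a b : V}
    (p : G.Walk a b) (hp : p.IsPath) (d : G.Dart) (hd : d ∈ p.darts) : d.symm ∉ p.darts := by
  induction p with
  | nil => simp at hd
  | @cons u v w h p ih =>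
    have hp' := hp
    rw [SimpleGraph.Walk.cons_isPath_iff] at hp
    intro hs
    have hsnd := aux_path_snd_ne _ hp' _ hs
    have hsnd2 := aux_path_snd_ne _ hp' _ hd
    simp only [SimpleGraph.Walk.darts_cons, List.mem_cons] at hd hs
    rcases hd with rfl | hd
    · simp at hsnd
    · rcases hs with hs | hs
      · apply hsnd2
        have := congrArg (fun e : G.Dart => e.fst) hs
        simpa using this
      · exact ih hp.1 hd hs

open Classical in
theorem aux_main {W V : Type*} [Fintype W] [Fintype V]
    (M : ℕ) (κ : ℝ) (hκ : 0 < κ)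
    (H : SimpleGraph W) (hH : IsExpander H κ)
    (G : SimpleGraph V) (hG : IsSubdivisionLE G H M) :
    ∃ φ : W → V, (∀ X : Set V, cut H (φ ⁻¹' X) ≤ cut G X ∧
      vol G X + cut G X ≤ M * vol H (φ ⁻¹' X) + M * cut G X) ∧
      (∀ X : Set V, vol G X = 0 ∨ κ ≤ 1) := by
  obtain ⟨φ, P, hφ, hpath, hlen1, hlenM, hrev, hint, hdisj, -, hedge⟩ := hG
  let A := {p : W × W // H.Adj p.1 p.2}
  let F : A → Finset (V × V) := fun a => ((P a.1.1 a.1.2 a.2).darts.map (fun d => d.toProd)).toFinset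
  have hF : ∀ (a : A) (q : V × V), q ∈ F a ↔ ∃ d ∈ (P a.1.1 a.1.2 a.2).darts, d.toProd = q := by
    intro a q; simp [F]
  have hFcard : ∀ a, (F a).card ≤ M := by
    intro a
    refine (List.toFinset_card_le _).trans ?_
    simpa using hlenM _ _ a.2
  have hFadj : ∀ a q, q ∈ F a → G.Adj q.1 q.2 := by
    intro a q hq
    obtain ⟨d, -, rfl⟩ := (hF a q).1 hq
    exact d.adj
  have hcov : ∀ q : V × V, G.Adj q.1 q.2 → ∃ a, q ∈ F a := by
    rintro ⟨x, y⟩ hq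
    obtain ⟨u, v, huv, he⟩ := hedge s(x, y) hq
    rw [SimpleGraph.Walk.edges, List.mem_map] at he
    obtain ⟨d, hd, he⟩ := he
    rcases (SimpleGraph.dart_edge_eq_mk'_iff.1 he) with h | h
    · exact ⟨⟨(u, v), huv⟩, (hF _ _).2 ⟨d, hd, h⟩⟩
    · refine ⟨⟨(v, u), huv.symm⟩, (hF _ _).2 ⟨d.symm, ?_, ?_⟩⟩
      · simp only [hrev u v huv]
        simpa using hd
      · simp [h]
  have huniq : ∀ a b q, q ∈ F a → q ∈ F b → a = b := by
    rintro ⟨⟨u, v⟩, huv⟩ ⟨⟨u', v'⟩, huv'⟩ q ha hb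
    obtain ⟨d, hd, rfl⟩ := (hF _ _).1 ha
    obtain ⟨d', hd', hdd⟩ := (hF _ _).1 hb
    obtain rfl : d' = d := SimpleGraph.Dart.ext _ _ hdd
    simp only at huv huv' hd hd'
    by_cases hs : s(u, v) = s(u', v')
    · rw [Sym2.eq_iff] at hs
      rcases hs with ⟨rfl, rfl⟩ | ⟨rfl, rfl⟩
      · rfl
      · exfalso
        rw [hrev u v huv] at hd'
        refine aux_path_symm _ (hpath u v huv) d' hd ?_
        simpa using hd'
    · have key : ∀ u v huv u' v' huv', s(u, v) ≠ s(u', v') → d' ∈ (P u v huv).darts →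
          d' ∈ (P u' v' huv').darts → d'.fst = φ u ∧ d'.snd = φ v := by
        intro u v huv u' v' huv' hs hd hd'
        have aux : ∀ z, z ∈ (P u' v' huv').support → z ∉ walkInternal (P u v huv) := by
          intro z hz hzi
          rcases aux_support_cases _ z hz with h | h | h
          · exact hint _ _ _ _ hzi ⟨_, h.symm⟩
          · exact hint _ _ _ _ hzi ⟨_, h.symm⟩
          · exact hdisj _ _ _ _ _ _ hs _ hzi h
        have f1 := aux_support_cases _ _ (SimpleGraph.Walk.dart_fst_mem_support_of_mem_darts _ hd)
        have f2 := aux_support_cases _ _ (SimpleGraph.Walk.dart_snd_mem_support_of_mem_darts _ hd)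
        have g1 := aux _ (SimpleGraph.Walk.dart_fst_mem_support_of_mem_darts _ hd')
        have g2 := aux _ (SimpleGraph.Walk.dart_snd_mem_support_of_mem_darts _ hd')
        have n1 := aux_path_fst_ne _ (hpath u v huv) _ hd
        have n2 := aux_path_snd_ne _ (hpath u v huv) _ hd
        tauto
      obtain ⟨k1, k2⟩ := key _ _ huv _ _ huv' hs hd hd'
      obtain ⟨k3, k4⟩ := key _ _ huv' _ _ huv (Ne.symm hs) hd' hd
      obtain rfl := hφ (k1.symm.trans k3)
      obtain rfl := hφ (k2.symm.trans k4)
      rfl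
  have hC : ∀ X : Set V, ∑ a : A, ((F a).filter (fun q => q.1 ∉ X ∧ q.2 ∈ X)).card ≤ cut G X := by
    intro X
    rw [← aux_cut_compl, aux_cut_eq, ← Finset.card_biUnion]
    · refine Finset.card_le_card fun q hq => ?_
      simp only [Finset.mem_biUnion, Finset.mem_filter, Finset.mem_univ, true_and] at hq ⊢
      obtain ⟨a, hq, h1, h2⟩ := hq
      exact ⟨h1, by simpa using h2, hFadj a q hq⟩
    · intro a _ b _ hab
      rw [Function.onFun, Finset.disjoint_left]
      intro q hqa hqb
      exact hab (huniq a b q (Finset.mem_filter.1 hqa).1 (Finset.mem_filter.1 hqb).1)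
  refine ⟨φ, fun X => ⟨?_, ?_⟩, ?_⟩
  · -- cut H ≤ cut G
    have : cut H (φ ⁻¹' X) = cut H (φ ⁻¹' Xᶜ) := by
      rw [← aux_cut_compl]; rfl
    rw [this]
    refine le_trans ?_ (hC X)
    have e : cut H (φ ⁻¹' Xᶜ) =
        ∑ a : A, if φ a.1.1 ∉ X ∧ φ a.1.2 ∈ X then 1 else 0 := by
      rw [Finset.sum_boole, aux_cut_eq, Nat.cast_id]
      symm
      refine Finset.card_bij (fun a _ => a.1) ?_ ?_ ?_
      · intro a ha
        simp at ha ⊢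
        exact ⟨ha.1, ha.2, a.2⟩
      · intro a _ b _ h; exact Subtype.ext h
      · intro q hq
        simp at hq
        exact ⟨⟨q, hq.2.2⟩, by simp [hq.1, hq.2.1], rfl⟩
    rw [e]
    refine Finset.sum_le_sum fun a _ => ?_
    split_ifs with h
    · obtain ⟨d, hd, h1, h2⟩ := aux_exists_cross X (P _ _ a.2) h.1 _
        (SimpleGraph.Walk.end_mem_support _) h.2
      exact Finset.card_pos.2 ⟨d.toProd, Finset.mem_filter.2 ⟨(hF _ _).2 ⟨d, hd, rfl⟩, h1, h2⟩⟩
    · exact Nat.zero_le _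
  · have e : vol H (φ ⁻¹' X) = ∑ a : A, if φ a.1.1 ∈ X then 1 else 0 := by
      rw [Finset.sum_boole, aux_vol_eq, Nat.cast_id]
      symm
      refine Finset.card_bij (fun a _ => a.1) ?_ ?_ ?_
      · intro a ha
        simp at ha ⊢
        exact ⟨ha, a.2⟩
      · intro a _ b _ h; exact Subtype.ext h
      · intro q hq
        simp at hq
        exact ⟨⟨q, hq.2⟩, by simp [hq.1], rfl⟩
    have hv : vol G X ≤ ∑ a : A, ((F a).filter (fun q => q.1 ∈ X)).card := by
      rw [aux_vol_eq]
      refine le_trans (Finset.card_le_card ?_) Finset.card_biUnion_le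
      intro q hq
      simp only [Finset.mem_biUnion, Finset.mem_filter, Finset.mem_univ, true_and] at hq ⊢
      obtain ⟨a, ha⟩ := hcov q hq.2
      exact ⟨a, ha, hq.1⟩
    have hloc : ∀ a : A, ((F a).filter (fun q => q.1 ∈ X)).card ≤
        M * (if φ a.1.1 ∈ X then 1 else 0) +
        (M - 1) * ((F a).filter (fun q => q.1 ∉ X ∧ q.2 ∈ X)).card := by
      intro a
      split_ifs with h
      · have := (Finset.card_filter_le (F a) (fun q => q.1 ∈ X)).trans (hFcard a)
        omega
      · rcases Finset.eq_empty_or_nonempty ((F a).filter (fun q => q.1 ∈ X)) with h0 | ⟨q, hq⟩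
        · rw [h0]; simp
        · rw [Finset.mem_filter] at hq
          obtain ⟨d, hd, rfl⟩ := (hF _ _).1 hq.1
          obtain ⟨d', hd', h1, h2⟩ := aux_exists_cross X (P _ _ a.2) h _
            (SimpleGraph.Walk.dart_fst_mem_support_of_mem_darts _ hd) hq.2
          have hm : d'.toProd ∈ F a := (hF _ _).2 ⟨d', hd', rfl⟩
          have hpos : 1 ≤ ((F a).filter (fun q => q.1 ∉ X ∧ q.2 ∈ X)).card :=
            Finset.card_pos.2 ⟨d'.toProd, Finset.mem_filter.2 ⟨hm, h1, h2⟩⟩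
          have hlt : ((F a).filter (fun q => q.1 ∈ X)).card < (F a).card := by
            refine Finset.card_lt_card ?_
            rw [Finset.filter_ssubset]
            exact ⟨_, hm, h1⟩
          have hle : ((F a).filter (fun q => q.1 ∈ X)).card ≤ M - 1 := by
            have := hFcard a
            omega
          nlinarith
    have hsum := hv.trans (Finset.sum_le_sum fun a _ => hloc a)
    rw [Finset.sum_add_distrib, ← Finset.mul_sum, ← Finset.mul_sum, ← e] at hsum
    have h3 := Nat.mul_le_mul_left (M - 1) (hC X)
    rcases Nat.eq_zero_or_pos M with h0 | h0
    · -- no edges at all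
      have hA : IsEmpty A := ⟨fun a => by have := hlen1 _ _ a.2; have := hlenM _ _ a.2; omega⟩
      have : cut G X = 0 := by
        rw [aux_cut_eq, Finset.card_eq_zero, Finset.filter_eq_empty_iff]
        rintro q - ⟨-, -, h⟩
        exact hA.elim (hcov q h).choose
      subst h0
      simp at hsum
      omega
    · obtain ⟨m, rfl⟩ : ∃ m, M = m + 1 := ⟨M - 1, by omega⟩
      simp only [Nat.add_sub_cancel] at hsum h3
      have : (m + 1) * cut G X = m * cut G X + cut G X := by ring
      omega
  · intro X
    rcases isEmpty_or_nonempty A with hA | ⟨⟨⟨u, v⟩, huv⟩⟩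
    · left
      rw [aux_vol_eq, Finset.card_eq_zero, Finset.filter_eq_empty_iff]
      rintro q - ⟨-, h⟩
      exact hA.elim (hcov q h).choose
    · right
      have h := hH {u}
      have c1 : (cut H {u} : ℝ) ≤ vol H {u} := by exact_mod_cast aux_cut_le_vol H {u}
      have c2 : (cut H {u} : ℝ) ≤ vol H {u}ᶜ := by
        rw [← aux_cut_compl]
        exact_mod_cast aux_cut_le_vol H {u}ᶜ
      have c0 : (0 : ℝ) < cut H {u} := by
        rw [aux_cut_eq]
        simp only [Nat.cast_pos]
        refine Finset.card_pos.2 ⟨(u, v), ?_⟩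
        simp only [Finset.mem_filter, Finset.mem_univ, true_and]
        exact ⟨rfl, fun h => huv.ne h.symm, huv⟩
      have := le_min c1 c2
      by_contra hc
      push Not at hc
      nlinarith

/-- Let `M ≥ 2` and let `H` be a finite `κ`-expander. If `G` is a subdivision
of `H` in which every subdividing path has at most `M` edges, then `G` is a
`κ/(2M - 1)`-expander. -/
theorem subdivision_isExpander {W V : Type*} [Fintype W] [Fintype V]
    (M : ℕ) (hM : 2 ≤ M) (κ : ℝ)
    (H : SimpleGraph W) (hH : IsExpander H κ)
    (G : SimpleGraph V) (hG : IsSubdivisionLE G H M) :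
    IsExpander G (κ / (2 * (M : ℝ) - 1)) := by
  have hM' : (2 : ℝ) ≤ M := by exact_mod_cast hM
  have hpos : (0 : ℝ) < 2 * (M : ℝ) - 1 := by linarith
  intro X
  rw [div_mul_eq_mul_div, div_le_iff₀ hpos]
  rcases le_or_gt κ 0 with hκ | hκ
  · have h1 : (0 : ℝ) ≤ min (vol G X : ℝ) (vol G Xᶜ : ℝ) := by positivity
    have h2 : (0 : ℝ) ≤ (cut G X : ℝ) * (2 * (M : ℝ) - 1) := by positivity
    nlinarith
  obtain ⟨φ, hmain, hκ1⟩ := aux_main M κ hκ H hH G hG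
  have key : ∀ X : Set V, vol H (φ ⁻¹' X) ≤ vol H (φ ⁻¹' X)ᶜ →
      κ * (vol G X : ℝ) ≤ cut G X * (2 * (M : ℝ) - 1) := by
    intro X hX
    rcases hκ1 X with h0 | h1
    · rw [h0]
      simp only [Nat.cast_zero, mul_zero]
      positivity
    · have e := hH (φ ⁻¹' X)
      rw [min_eq_left (by exact_mod_cast hX)] at e
      have a1 : (cut H (φ ⁻¹' X) : ℝ) ≤ cut G X := by exact_mod_cast (hmain X).1
      have a2 : (vol G X : ℝ) + cut G X ≤ M * vol H (φ ⁻¹' X) + M * cut G X := by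
        exact_mod_cast (hmain X).2
      have a3 : (0 : ℝ) ≤ cut G X := by positivity
      calc κ * (vol G X : ℝ) ≤ κ * (M * vol H (φ ⁻¹' X) + (M - 1) * cut G X) := by
            gcongr; linarith
        _ = M * (κ * vol H (φ ⁻¹' X)) + κ * ((M - 1) * cut G X) := by ring
        _ ≤ M * cut G X + 1 * ((M - 1) * cut G X) := by
            have : (0 : ℝ) ≤ (M - 1) * cut G X := mul_nonneg (by linarith) a3
            gcongr
            exact e.trans a1
        _ = _ := by ring
  rcases le_total (vol H (φ ⁻¹' X)) (vol H (φ ⁻¹' X)ᶜ) with h | h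
  · refine le_trans ?_ (key X h)
    gcongr
    exact min_le_left _ _
  · have k := key Xᶜ (by rw [Set.preimage_compl, compl_compl]; exact h)
    rw [aux_cut_compl] at k
    refine le_trans ?_ k
    gcongr
    exact min_le_right _ _
end

section
/- For all κ with 0 < κ ≤ 1 and all ε, α > 0, there exists M > 0 such that the following holds. Let G be a finite graph and let R be a spanning subgraph of G such that R is a κ-expander and e(R) ≥ α·e(G). Then there exists a vertex set S ⊆ V(G) such that, writing G* = G[S] and R* = R[S] for the induced subgraphs on S: R* is a (κ/3)-expander; for every vertex v ∈ S, deg_{G*}(v) ≤ 3M·deg_{R*}(v); and e(G*) ≥ (1 − ε·(1 + 3/κ))·e(R). -/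
universe u

set_option linter.unusedSectionVars false
set_option linter.unusedVariables false

section core
open Finset
variable {V : Type*} [Fintype V] [DecidableEq V]

noncomputable def eW (a : V → V → ℝ) (A B : Finset V) : ℝ := ∑ x ∈ A, ∑ y ∈ B, a x y

lemma eW_symm {a : V → V → ℝ} (hs : ∀ x y, a x y = a y x) (A B : Finset V) :
    eW a A B = eW a B A := by
  unfold eW
  rw [Finset.sum_comm]
  exact Finset.sum_congr rfl fun x _ => Finset.sum_congr rfl fun y _ => hs _ _

lemma eW_nonneg {a : V → V → ℝ} (h0 : ∀ x y, 0 ≤ a x y) (A B : Finset V) : 0 ≤ eW a A B :=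
  Finset.sum_nonneg fun x _ => Finset.sum_nonneg fun y _ => h0 _ _

lemma eW_union {a : V → V → ℝ} {A A' : Finset V} (h : Disjoint A A') (B : Finset V) :
    eW a (A ∪ A') B = eW a A B + eW a A' B := by
  unfold eW
  exact Finset.sum_union h

lemma eW_union_r {a : V → V → ℝ} {B B' : Finset V} (h : Disjoint B B') (A : Finset V) :
    eW a A (B ∪ B') = eW a A B + eW a A B' := by
  unfold eW
  rw [← Finset.sum_add_distrib]
  exact Finset.sum_congr rfl fun x _ => Finset.sum_union h

lemma eW_mono {a : V → V → ℝ} (h0 : ∀ x y, 0 ≤ a x y) {A A' B B' : Finset V}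
    (hA : A ⊆ A') (hB : B ⊆ B') : eW a A B ≤ eW a A' B' := by
  unfold eW
  refine (Finset.sum_le_sum fun x _ =>
    Finset.sum_le_sum_of_subset_of_nonneg hB fun y _ _ => h0 x y).trans ?_
  exact Finset.sum_le_sum_of_subset_of_nonneg hA fun x _ _ => Finset.sum_nonneg fun y _ => h0 x y

lemma core_exists {a : V → V → ℝ} (h0 : ∀ x y, 0 ≤ a x y) (hs : ∀ x y, a x y = a y x)
    {κ : ℝ} (hκ : 0 < κ)
    (hexp : ∀ X : Finset V, κ * min (eW a X univ) (eW a Xᶜ univ) ≤ eW a X Xᶜ)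
    (B : Finset V) (hb : eW a B univ ≤ κ * eW a univ univ / 36) :
    ∃ S : Finset V, Disjoint S B ∧
      (∀ X ⊆ S, eW a X univ ≤ eW a univ univ / 2 → κ / 3 * eW a X univ ≤ eW a X (S \ X)) ∧
      eW a univ univ - 2 * (1 + 6 / κ) * eW a B univ ≤ eW a S S := by
  classical
  set m := eW a univ univ with hm
  set P : Finset V → Prop := fun U => Disjoint U B ∧ eW a U (B ∪ U)ᶜ ≤ κ / 3 * eW a U univ ∧
    eW a U univ ≤ 2 / 3 * m with hP
  have hm0 : 0 ≤ m := eW_nonneg h0 _ _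
  have hne : (univ.filter P).Nonempty := by
    refine ⟨∅, ?_⟩
    simp [hP, eW, hm0]
  obtain ⟨U, hU, hmax⟩ := Finset.exists_max_image _ Finset.card hne
  simp only [mem_filter, mem_univ, true_and] at hU hmax
  obtain ⟨hUB, hUc, hUm⟩ := hU
  have split : ∀ X : Finset V, eW a X univ + eW a Xᶜ univ = m := fun X => by
    rw [← eW_union disjoint_compl_right, union_compl]
  have hvol : eW a U univ ≤ 6 / κ * eW a B univ := by
    have h1 := hexp U
    have h2 := split U
    have h3 : eW a U univ / 2 ≤ min (eW a U univ) (eW a Uᶜ univ) := by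
      have := eW_nonneg h0 U univ
      refine le_min ?_ ?_ <;> linarith
    have h4 : eW a U Uᶜ ≤ eW a U B + eW a U (B ∪ U)ᶜ := by
      rw [← eW_union_r]
      · refine eW_mono h0 subset_rfl ?_
        intro x; simp; tauto
      · rw [Finset.disjoint_left]; intro x; simp; tauto
    have h5 : eW a U B ≤ eW a B univ := by
      rw [eW_symm hs]; exact eW_mono h0 subset_rfl (subset_univ _)
    have h6 := mul_le_mul_of_nonneg_left h3 hκ.le
    have h7 : κ * eW a U univ ≤ 6 * eW a B univ := by linarith
    rw [div_mul_eq_mul_div, le_div_iff₀ hκ]; linarith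
  refine ⟨(B ∪ U)ᶜ, ?_, ?_, ?_⟩
  · rw [Finset.disjoint_left]; intro x; simp; tauto
  · intro X hX hXm
    by_contra! hlt
    have hXne : X.Nonempty := by
      rw [Finset.nonempty_iff_ne_empty]
      rintro rfl
      simp [eW] at hlt
    have hXU : Disjoint U X := by
      rw [Finset.disjoint_left]; intro x hx hx'
      have := hX hx'; simp at this; tauto
    have hbU : eW a U univ ≤ m / 6 := by
      refine hvol.trans ?_
      rw [div_mul_eq_mul_div, div_le_iff₀ hκ]; linarith
    have hPU : P (U ∪ X) := by
      refine ⟨?_, ?_, ?_⟩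
      · rw [Finset.disjoint_union_left]
        refine ⟨hUB, ?_⟩
        rw [Finset.disjoint_left]; intro x hx hx'
        have := hX hx; simp at this; tauto
      · rw [eW_union hXU, eW_union hXU]
        have e1 : eW a U (B ∪ (U ∪ X))ᶜ ≤ eW a U (B ∪ U)ᶜ := by
          refine eW_mono h0 subset_rfl ?_
          intro x; simp; tauto
        have e2 : eW a X (B ∪ (U ∪ X))ᶜ ≤ eW a X ((B ∪ U)ᶜ \ X) := by
          refine eW_mono h0 subset_rfl ?_
          intro x; simp; tauto
        linarith
      · rw [eW_union hXU]; linarith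
    have := hmax _ hPU
    rw [card_union_of_disjoint hXU] at this
    have := hXne.card_pos
    omega
  · set S := (B ∪ U)ᶜ with hS
    have e1 := split S
    have e2 : eW a S univ = eW a S S + eW a S Sᶜ := by
      rw [← eW_union_r disjoint_compl_right, union_compl]
    have e3 : eW a S Sᶜ ≤ eW a Sᶜ univ := by
      rw [eW_symm hs]; exact eW_mono h0 subset_rfl (subset_univ _)
    have e4 : eW a Sᶜ univ = eW a B univ + eW a U univ := by
      rw [hS, compl_compl, eW_union hUB.symm]
    nlinarith

end core

section bridge
open Finset

open Classical in
noncomputable def adjW {V : Type*} (G : SimpleGraph V) (x y : V) : ℝ := if G.Adj x y then 1 else 0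

lemma adjW_nonneg {V : Type*} (G : SimpleGraph V) (x y : V) : 0 ≤ adjW G x y := by
  unfold adjW; split_ifs <;> norm_num

lemma adjW_symm {V : Type*} (G : SimpleGraph V) (x y : V) : adjW G x y = adjW G y x := by
  unfold adjW; rw [G.adj_comm]

lemma vdeg_eq {V : Type*} [Fintype V] (G : SimpleGraph V) (v : V) :
    (vdeg G v : ℝ) = ∑ y, adjW G v y := by
  classical
  unfold vdeg adjW
  rw [Nat.card_eq_fintype_card, SimpleGraph.card_neighborSet_eq_degree,
    ← SimpleGraph.card_neighborFinset_eq_degree, SimpleGraph.neighborFinset_eq_filter]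
  simp

lemma vol_eq {V : Type*} [Fintype V] [DecidableEq V] (G : SimpleGraph V) (X : Finset V) :
    (vol G (X : Set V) : ℝ) = eW (adjW G) X univ := by
  unfold vol eW
  rw [finsum_mem_coe_finset]
  push_cast
  exact Finset.sum_congr rfl fun v _ => vdeg_eq G v

lemma cut_eq {V : Type*} [Fintype V] [DecidableEq V] (G : SimpleGraph V) (X : Finset V) :
    (cut G (X : Set V) : ℝ) = eW (adjW G) X Xᶜ := by
  classical
  unfold cut eW adjW
  rw [Nat.card_eq_fintype_card, Fintype.card_subtype, ← Finset.sum_product', Finset.sum_boole]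
  congr 2
  ext p
  simp [and_assoc]

lemma edge_eq {V : Type*} [Fintype V] [DecidableEq V] (G : SimpleGraph V) :
    2 * (edgeCount G : ℝ) = eW (adjW G) univ univ := by
  classical
  have h := G.sum_degrees_eq_twice_card_edges
  unfold edgeCount eW
  rw [Nat.card_eq_fintype_card, ← SimpleGraph.edgeFinset_card]
  have h' : ((∑ v, G.degree v : ℕ) : ℝ) = 2 * (#G.edgeFinset : ℝ) := by exact_mod_cast h
  rw [← h']
  push_cast
  refine Finset.sum_congr rfl fun v _ => ?_
  rw [← vdeg_eq, vdeg, Nat.card_eq_fintype_card, SimpleGraph.card_neighborSet_eq_degree]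

lemma eW_induce {V : Type*} [Fintype V] [DecidableEq V] (G : SimpleGraph V) (S : Finset V)
    (A B : Finset (S : Set V)) :
    eW (adjW (G.induce (S : Set V))) A B =
      eW (adjW G) (A.map (Function.Embedding.subtype _)) (B.map (Function.Embedding.subtype _)) := by
  unfold eW
  simp only [Finset.sum_map]
  rfl

end bridge

/-- For all `0 < κ ≤ 1` and `ε, α > 0` there exists `M > 0` such that:
for any finite graph `G` and spanning subgraph `R ≤ G` with `R` a `κ`-expander and
`e(R) ≥ α·e(G)`, there is a vertex set `S` such that, with `G* = G[S]` and `R* = R[S]`,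
`R*` is a `κ/3`-expander, `deg_{G*}(v) ≤ 3M·deg_{R*}(v)` for every `v ∈ S`, and
`e(G*) ≥ (1 - ε(1 + 3/κ))·e(R)`. -/
theorem exists_induced_expander_of_spanning_subgraph
    (κ ε α : ℝ) (hκ0 : 0 < κ) (hκ1 : κ ≤ 1) (hε : 0 < ε) (hα : 0 < α) :
    ∃ M : ℝ, 0 < M ∧
      ∀ (V : Type u) [Fintype V] (G R : SimpleGraph V),
        R ≤ G → IsExpander R κ → α * (edgeCount G : ℝ) ≤ (edgeCount R : ℝ) →
        ∃ S : Set V,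
          IsExpander (R.induce S) (κ / 3) ∧
          (∀ v : S, (vdeg (G.induce S) v : ℝ) ≤ 3 * M * (vdeg (R.induce S) v : ℝ)) ∧
          (1 - ε * (1 + 3 / κ)) * (edgeCount R : ℝ) ≤ (edgeCount (G.induce S) : ℝ) := by
  classical
  obtain ⟨δ, hδ0, hδε, hδκ⟩ : ∃ δ : ℝ, 0 < δ ∧ δ ≤ ε / 4 ∧ δ ≤ κ / 36 :=
    ⟨min (ε / 4) (κ / 36), by positivity, min_le_left _ _, min_le_right _ _⟩
  have hM0 : 0 < 1 / (α * δ) := by positivity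
  obtain ⟨N, hN⟩ : ∃ N, N = 1 / (α * δ) := ⟨_, rfl⟩
  have hN0 : 0 < N := hN ▸ hM0
  refine ⟨N / κ, by positivity, ?_⟩
  intro V _ G R hRG hR hE
  have hle : ∀ x y, adjW R x y ≤ adjW G x y := by
    intro x y
    unfold adjW
    by_cases h : R.Adj x y
    · simp [h, hRG h]
    · simp only [h, if_false]; split_ifs <;> norm_num
  have hexp : ∀ X : Finset V, κ * min (eW (adjW R) X Finset.univ) (eW (adjW R) Xᶜ Finset.univ)
      ≤ eW (adjW R) X Xᶜ := by
    intro X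
    have := hR (X : Set V)
    rw [← Finset.coe_compl, vol_eq, vol_eq, cut_eq] at this
    exact this
  set m := eW (adjW R) Finset.univ Finset.univ with hm
  have hmR : 2 * (edgeCount R : ℝ) = m := edge_eq R
  have hmG := edge_eq G
  have hm0 : 0 ≤ m := eW_nonneg (adjW_nonneg R) _ _
  set B : Finset V := Finset.univ.filter fun v => N * (vdeg R v : ℝ) < vdeg G v with hB
  have hb : eW (adjW R) B Finset.univ ≤ δ * m := by
    have h1 : N * eW (adjW R) B Finset.univ ≤ eW (adjW G) B Finset.univ := by
      unfold eW
      rw [Finset.mul_sum]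
      refine Finset.sum_le_sum fun v hv => ?_
      rw [← vdeg_eq, ← vdeg_eq]
      exact (Finset.mem_filter.1 hv).2.le
    have h2 : eW (adjW G) B Finset.univ ≤ eW (adjW G) Finset.univ Finset.univ :=
      eW_mono (adjW_nonneg G) (Finset.subset_univ _) subset_rfl
    have h3 : α * eW (adjW G) Finset.univ Finset.univ ≤ m := by rw [← hmG, ← hmR]; linarith
    have h4 : α * (N * eW (adjW R) B Finset.univ) ≤ m :=
      (mul_le_mul_of_nonneg_left (h1.trans h2) hα.le).trans h3
    have h5 := mul_le_mul_of_nonneg_left h4 hδ0.le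
    have h6 : δ * (α * (N * eW (adjW R) B Finset.univ)) = eW (adjW R) B Finset.univ := by
      rw [hN]; field_simp
    linarith
  obtain ⟨S, hSB, hS, hSm⟩ := core_exists (adjW_nonneg R) (adjW_symm R) hκ0 hexp B
    (by rw [← hm]; nlinarith)
  rw [← hm] at hS hSm
  have huniv : (Finset.univ : Finset (S : Set V)).map (Function.Embedding.subtype _) = S := by
    ext x; simp
  have hb0 : 0 ≤ eW (adjW R) B Finset.univ := eW_nonneg (adjW_nonneg R) _ _
  refine ⟨(S : Set V), ?_, ?_, ?_⟩
  · intro X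
    obtain ⟨X, rfl⟩ : ∃ Y : Finset (S : Set V), X = (Y : Set _) := ⟨X.toFinset, by simp⟩
    rw [← Finset.coe_compl, vol_eq, vol_eq, cut_eq, eW_induce, eW_induce, eW_induce, huniv]
    set A := X.map (Function.Embedding.subtype _) with hA
    have hAS : A ⊆ S := by intro x; simp [hA]; tauto
    have hAc : Xᶜ.map (Function.Embedding.subtype _) = S \ A := by
      ext x; simp [hA]; tauto
    rw [hAc]
    have hsum : eW (adjW R) A Finset.univ + eW (adjW R) (S \ A) Finset.univ ≤ m := by
      rw [← eW_union Finset.disjoint_sdiff]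
      exact eW_mono (adjW_nonneg R) (Finset.subset_univ _) subset_rfl
    have m1 : eW (adjW R) A S ≤ eW (adjW R) A Finset.univ :=
      eW_mono (adjW_nonneg R) subset_rfl (Finset.subset_univ _)
    have m2 : eW (adjW R) (S \ A) S ≤ eW (adjW R) (S \ A) Finset.univ :=
      eW_mono (adjW_nonneg R) subset_rfl (Finset.subset_univ _)
    have hκ3 : 0 ≤ κ / 3 := by positivity
    by_cases hc : eW (adjW R) A Finset.univ ≤ m / 2
    · refine le_trans ?_ (hS A hAS hc)
      exact mul_le_mul_of_nonneg_left ((min_le_left _ _).trans m1) hκ3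
    · have h := hS (S \ A) Finset.sdiff_subset (by linarith)
      rw [Finset.sdiff_sdiff_eq_self hAS, eW_symm (adjW_symm R) (S \ A) A] at h
      refine le_trans ?_ h
      exact mul_le_mul_of_nonneg_left ((min_le_right _ _).trans m2) hκ3
  · rintro ⟨v, hv⟩
    have hvS : v ∈ S := hv
    have hdeg : ∀ H : SimpleGraph V, (vdeg (H.induce (S : Set V)) ⟨v, hv⟩ : ℝ) =
        eW (adjW H) {v} S := by
      intro H
      have := eW_induce H S {⟨v, hv⟩} Finset.univ
      rw [huniv] at this
      rw [vdeg_eq]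
      simpa [eW] using this
    have hdeg' : ∀ H : SimpleGraph V, (vdeg H v : ℝ) = eW (adjW H) {v} Finset.univ := by
      intro H; rw [vdeg_eq]; simp [eW]
    rw [hdeg, hdeg]
    have hvB : v ∉ B := Finset.disjoint_left.1 hSB hvS
    have h1 : eW (adjW G) {v} Finset.univ ≤ N * eW (adjW R) {v} Finset.univ := by
      rw [← hdeg', ← hdeg']
      simpa [hB] using hvB
    have h2 : eW (adjW G) {v} S ≤ eW (adjW G) {v} Finset.univ :=
      eW_mono (adjW_nonneg G) subset_rfl (Finset.subset_univ _)
    have h3 : eW (adjW R) {v} Finset.univ ≤ m / 2 := by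
      have e1 : eW (adjW R) {v} Finset.univ + eW (adjW R) {v}ᶜ Finset.univ = m := by
        rw [← eW_union disjoint_compl_right, Finset.union_compl]
      have e2 : eW (adjW R) {v} Finset.univ = eW (adjW R) {v} {v} + eW (adjW R) {v} {v}ᶜ := by
        rw [← eW_union_r disjoint_compl_right, Finset.union_compl]
      have e3 : eW (adjW R) {v} {v} = 0 := by simp [eW, adjW]
      have e4 : eW (adjW R) {v} {v}ᶜ ≤ eW (adjW R) {v}ᶜ Finset.univ := by
        rw [eW_symm (adjW_symm R)]
        exact eW_mono (adjW_nonneg R) subset_rfl (Finset.subset_univ _)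
      linarith
    have h4 := hS {v} (by simpa using hvS) h3
    have h5 : eW (adjW R) {v} (S \ {v}) ≤ eW (adjW R) {v} S :=
      eW_mono (adjW_nonneg R) subset_rfl Finset.sdiff_subset
    have h6 := mul_le_mul_of_nonneg_left (h4.trans h5) (show 0 ≤ 3 * (N / κ) by positivity)
    have h7 : 3 * (N / κ) * (κ / 3 * eW (adjW R) {v} Finset.univ) =
        N * eW (adjW R) {v} Finset.univ := by field_simp
    linarith
  · have e1 := edge_eq (G.induce (S : Set V))
    rw [eW_induce, huniv] at e1
    have e2 : eW (adjW R) S S ≤ eW (adjW G) S S :=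
      Finset.sum_le_sum fun x _ => Finset.sum_le_sum fun y _ => hle x y
    have e3 : 2 * (1 + 6 / κ) * eW (adjW R) B Finset.univ ≤ ε * (1 + 3 / κ) * m := by
      have k : 0 < 3 / κ := by positivity
      have k2 : 6 / κ = 2 * (3 / κ) := by ring
      rw [k2]
      have hbe : eW (adjW R) B Finset.univ ≤ ε / 4 * m :=
        hb.trans (mul_le_mul_of_nonneg_right hδε hm0)
      calc 2 * (1 + 2 * (3 / κ)) * eW (adjW R) B Finset.univ
          ≤ 4 * (1 + 3 / κ) * eW (adjW R) B Finset.univ :=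
            mul_le_mul_of_nonneg_right (by linarith) hb0
        _ ≤ 4 * (1 + 3 / κ) * (ε / 4 * m) := mul_le_mul_of_nonneg_left hbe (by positivity)
        _ = _ := by ring
    have : (1 - ε * (1 + 3 / κ)) * (edgeCount R : ℝ) = (m - ε * (1 + 3 / κ) * m) / 2 := by
      rw [← hmR]; ring
    rw [this]; linarith
end
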